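/- Let I ⊆ S be a monomial ideal with linear quotients with respect to the ordering m_1, ..., m_t, with critical-index sets A_i, and assume I is crit-monotone. Then the complex G̃ defined below is a minimal free resolution of S/I: d ∘ d = 0; H_p(G̃) = 0 for all p ≥ 1; the image of d_1: G̃_1 → G̃_0 = S equals I (so H_0(G̃) ≅ S/I); and d(G̃_p) ⊆ (x_1,...,x_n)·G̃_{p−1} for all p ≥ 1. -/

import Mathlib

open MvPolynomial
open scoped Classical

/-- The colon ideal `(m_1,…,m_{i−1}) : m_i` of a list of monomials given by exponent
vectors `m : Fin t → (Fin n →₀ ℕ)`. -/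
noncomputable def colonIdeal (k : Type) [Field k] (n t : ℕ) (m : Fin t → (Fin n →₀ ℕ))
    (i : Fin t) : Ideal (MvPolynomial (Fin n) k) :=
  Submodule.colon (Ideal.span ((fun j => monomial (m j) (1 : k)) '' {j | j < i}))
    (Ideal.span {monomial (m i) (1 : k)})

/-- The critical-index set `A_i = { j : x_j ∈ (m_1,…,m_{i−1}) : m_i }`. -/
def critSet (k : Type) [Field k] (n t : ℕ) (m : Fin t → (Fin n →₀ ℕ)) (i : Fin t) :
    Set (Fin n) :=
  {j | (X j : MvPolynomial (Fin n) k) ∈ colonIdeal k n t m i}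

/-- Index set for the basis `e_J g_i` (with `J ⊆ A_i`, `|J| = p`) of the `(p+1)`-st module
of the Eliahou–Kervaire-type complex `G̃`. -/
def EKIndex (k : Type) [Field k] (n t : ℕ) (m : Fin t → (Fin n →₀ ℕ)) (p : ℕ) : Type :=
  {q : Fin t × Finset (Fin n) // ↑q.2 ⊆ critSet k n t m q.1 ∧ q.2.card = p}

/-- The modules of the Eliahou–Kervaire-type complex `G̃`: `G̃_0 = S` and, for `p ≥ 1`,
`G̃_p` is the free `S`-module on the symbols `e_J g_i` with `J ⊆ A_i`, `|J| = p − 1`. -/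
noncomputable def EKMod (k : Type) [Field k] (n t : ℕ) (m : Fin t → (Fin n →₀ ℕ)) :
    ℕ → Type
  | 0 => MvPolynomial (Fin n) k
  | (p + 1) => EKIndex k n t m p →₀ MvPolynomial (Fin n) k

noncomputable instance (k : Type) [Field k] (n t : ℕ) (m : Fin t → (Fin n →₀ ℕ)) (p : ℕ) :
    AddCommGroup (EKMod k n t m p) := by
  cases p with
  | zero => exact inferInstanceAs (AddCommGroup (MvPolynomial (Fin n) k))
  | succ p =>
      exact inferInstanceAs (AddCommGroup (EKIndex k n t m p →₀ MvPolynomial (Fin n) k))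

noncomputable instance (k : Type) [Field k] (n t : ℕ) (m : Fin t → (Fin n →₀ ℕ)) (p : ℕ) :
    Module (MvPolynomial (Fin n) k) (EKMod k n t m p) := by
  cases p with
  | zero => exact inferInstanceAs (Module (MvPolynomial (Fin n) k) (MvPolynomial (Fin n) k))
  | succ p =>
      exact inferInstanceAs
        (Module (MvPolynomial (Fin n) k) (EKIndex k n t m p →₀ MvPolynomial (Fin n) k))

noncomputable instance (k : Type) [Field k] (n t : ℕ) (m : Fin t → (Fin n →₀ ℕ)) (p : ℕ) :
    Module k (EKMod k n t m p) := by
  cases p with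
  | zero => exact inferInstanceAs (Module k (MvPolynomial (Fin n) k))
  | succ p =>
      exact inferInstanceAs (Module k (EKIndex k n t m p →₀ MvPolynomial (Fin n) k))

/-- The basis element `e_J g_i` of `G̃_{p+1}`. -/
noncomputable def ekGen (k : Type) [Field k] (n t : ℕ) (m : Fin t → (Fin n →₀ ℕ)) {p : ℕ}
    (i : Fin t) (J : Finset (Fin n)) (h1 : ↑J ⊆ critSet k n t m i) (h2 : J.card = p) :
    EKMod k n t m (p + 1) :=
  Finsupp.single ⟨(i, J), h1, h2⟩ 1

section EliahouKervaire

variable {k : Type} [Field k] {n t : ℕ} {m : Fin t → (Fin n →₀ ℕ)}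

instance (p : ℕ) : IsScalarTower k (MvPolynomial (Fin n) k) (EKMod k n t m p) := by
  cases p with
  | zero => exact inferInstanceAs (IsScalarTower k (MvPolynomial (Fin n) k)
      (MvPolynomial (Fin n) k))
  | succ p => exact inferInstanceAs (IsScalarTower k (MvPolynomial (Fin n) k)
      (EKIndex k n t m p →₀ MvPolynomial (Fin n) k))

instance (p : ℕ) : Module.Free (MvPolynomial (Fin n) k) (EKMod k n t m p) := by
  cases p with
  | zero => exact inferInstanceAs (Module.Free (MvPolynomial (Fin n) k)
      (MvPolynomial (Fin n) k))
  | succ p => exact inferInstanceAs (Module.Free (MvPolynomial (Fin n) k)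
      (EKIndex k n t m p →₀ MvPolynomial (Fin n) k))

variable (k m) in
/-- The term `x^β e_J g_i` of `G̃_{p+1}`, read as `0` unless `J ⊆ A_i` and `|J| = p`. -/
noncomputable def ekTerm (p : ℕ) (i : Fin t) (J : Finset (Fin n)) (β : Fin n →₀ ℕ) :
    EKMod k n t m (p + 1) :=
  if h : ↑J ⊆ critSet k n t m i ∧ J.card = p then
    monomial β (1 : k) • ekGen k n t m i J h.1 h.2 else 0

theorem ekTerm_eq_single {p : ℕ} (q : EKIndex k n t m p) (β : Fin n →₀ ℕ) :
    ekTerm k m p q.1.1 q.1.2 β =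
      (Finsupp.single q (monomial β (1 : k)) : EKIndex k n t m p →₀ MvPolynomial (Fin n) k) := by
  rw [ekTerm, dif_pos q.2]
  exact (Finsupp.smul_single _ _ _).trans (by rw [smul_eq_mul, mul_one]; rfl)

theorem ekTerm_eq_zero {p : ℕ} {i : Fin t} {J : Finset (Fin n)} (β : Fin n →₀ ℕ)
    (h : ¬ ↑J ⊆ critSet k n t m i) : ekTerm k m p i J β = 0 :=
  dif_neg fun h' => h h'.1

theorem monomial_smul_ekTerm {p : ℕ} (i : Fin t) (J : Finset (Fin n)) (α β : Fin n →₀ ℕ) :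
    monomial α (1 : k) • ekTerm k m p i J β = ekTerm k m p i J (α + β) := by
  unfold ekTerm
  split_ifs
  · rw [smul_smul, monomial_mul, one_mul]
  · exact smul_zero _

theorem ekTerm_eq_smul {p : ℕ} {i : Fin t} {J : Finset (Fin n)} (β : Fin n →₀ ℕ)
    (h1 : ↑J ⊆ critSet k n t m i) (h2 : J.card = p) :
    ekTerm k m p i J β = monomial β (1 : k) • ekGen k n t m i J h1 h2 :=
  dif_pos ⟨h1, h2⟩

variable (k m) in
/-- The monomial `x^α` as an element of `G̃_0 = S`. -/
noncomputable def ekMonomial (α : Fin n →₀ ℕ) : EKMod k n t m 0 :=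
  (monomial α (1 : k) : MvPolynomial (Fin n) k)

theorem monomial_smul_ekMonomial (α β : Fin n →₀ ℕ) :
    monomial α (1 : k) • ekMonomial k m β = ekMonomial k m (α + β) :=
  monomial_mul.trans (by rw [one_mul]; rfl)

variable (k m) in
/-- The `k`-span of the terms `x^β e_J g_i` with `i < l`. -/
noncomputable def ekFiltration (p l : ℕ) : Submodule k (EKMod k n t m (p + 1)) :=
  Submodule.span k {z | ∃ (i : Fin t) (J : Finset (Fin n)) (β : Fin n →₀ ℕ), (i : ℕ) < l ∧ z = ekTerm k m p i J β}

theorem ekTerm_mem_ekFiltration {p l : ℕ} {i : Fin t} (h : (i : ℕ) < l) (J : Finset (Fin n))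
    (β : Fin n →₀ ℕ) : ekTerm k m p i J β ∈ ekFiltration k m p l :=
  Submodule.subset_span ⟨i, J, β, h, rfl⟩

theorem ekFiltration_mono {p l l' : ℕ} (h : l ≤ l') :
    ekFiltration k m p l ≤ ekFiltration k m p l' :=
  Submodule.span_mono fun _ ⟨i, J, β, hi, hz⟩ => ⟨i, J, β, hi.trans_le h, hz⟩

theorem ekFiltration_zero (p : ℕ) : ekFiltration k m p 0 = ⊥ := by
  rw [ekFiltration, Submodule.span_eq_bot]
  rintro _ ⟨i, J, β, h, -⟩
  exact absurd h (Nat.not_lt_zero _)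

/-- A `k`-subspace containing all terms `x^β e_J g_i` is everything. -/
theorem eq_top_of_ekTerm_mem {p : ℕ} (N : Submodule k (EKMod k n t m (p + 1)))
    (h : ∀ (i : Fin t) (J : Finset (Fin n)) (β : Fin n →₀ ℕ),
      ↑J ⊆ critSet k n t m i → J.card = p → ekTerm k m p i J β ∈ N) : N = ⊤ := by
  rw [eq_top_iff]
  rintro z -
  refine Finsupp.induction_linear (motive := fun z => z ∈ N) z N.zero_mem
    (fun _ _ => N.add_mem) fun q f => ?_
  induction f using MvPolynomial.induction_on' with
  | monomial β c =>
    have h1 := N.smul_mem c (h q.1.1 q.1.2 β q.2.1 q.2.2)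
    rw [ekTerm_eq_single] at h1
    have h2 : c • (Finsupp.single q (monomial β (1 : k)) :
        EKIndex k n t m p →₀ MvPolynomial (Fin n) k) = Finsupp.single q (monomial β c) := by
      rw [Finsupp.smul_single, smul_monomial, smul_eq_mul, mul_one]
    exact h2 ▸ h1
  | add f g hf hg =>
    have h1 := N.add_mem hf hg
    exact (Finsupp.single_add q f g : _) ▸ h1

theorem ekFiltration_eq_top (p : ℕ) : ekFiltration k m p t = ⊤ :=
  eq_top_of_ekTerm_mem _ fun i J β _ _ => ekTerm_mem_ekFiltration i.2 J β

/-- `j` is the least element of `J ∪ (supp β ∩ A_i)` and does not lie in `J`. -/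
def IsPivot (k : Type) [Field k] {n t : ℕ} (m : Fin t → (Fin n →₀ ℕ)) (i : Fin t)
    (J : Finset (Fin n)) (β : Fin n →₀ ℕ) (j : Fin n) : Prop :=
  j ∈ critSet k n t m i ∧ β j ≠ 0 ∧ j ∉ J ∧ (∀ x ∈ J, j ≤ x) ∧
    ∀ x ∈ critSet k n t m i, β x ≠ 0 → j ≤ x

theorem IsPivot.unique {i : Fin t} {J : Finset (Fin n)} {β : Fin n →₀ ℕ} {j j' : Fin n}
    (h : IsPivot k m i J β j) (h' : IsPivot k m i J β j') : j = j' :=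
  le_antisymm (h.2.2.2.2 _ h'.1 h'.2.1) (h'.2.2.2.2 _ h.1 h.2.1)

theorem exists_least_mem_critSet {i : Fin t} {β : Fin n →₀ ℕ} {x : Fin n}
    (hx : x ∈ critSet k n t m i) (hx0 : β x ≠ 0) :
    ∃ j ∈ critSet k n t m i, β j ≠ 0 ∧ ∀ y ∈ critSet k n t m i, β y ≠ 0 → j ≤ y := by
  obtain ⟨j, hj, hmin⟩ := WellFounded.has_min wellFounded_lt
    {y | y ∈ critSet k n t m i ∧ β y ≠ 0} ⟨x, hx, hx0⟩
  exact ⟨j, hj.1, hj.2, fun y hy hy0 => not_lt.1 (hmin y ⟨hy, hy0⟩)⟩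

variable (k m) in
/-- The value of the Koszul homotopy on the term `x^β e_J g_i`. -/
noncomputable def ekHomotopyTerm (p : ℕ) (i : Fin t) (J : Finset (Fin n)) (β : Fin n →₀ ℕ) :
    EKMod k n t m (p + 2) :=
  if h : ∃ j, IsPivot k m i J β j then
    ekTerm k m (p + 1) i (insert h.choose J) (β - Finsupp.single h.choose 1) else 0

theorem basisMonomials_constr_monomial {M : Type*} [AddCommGroup M] [Module k M]
    (f : (Fin n →₀ ℕ) → M) (α : Fin n →₀ ℕ) :
    (basisMonomials (Fin n) k).constr k f (monomial α 1) = f α := by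
  simpa using (basisMonomials (Fin n) k).constr_basis k f α

variable (k m) in
/-- The `k`-linear contraction of the Koszul parts of `G̃`. -/
noncomputable def ekHomotopy (p : ℕ) : EKMod k n t m (p + 1) →ₗ[k] EKMod k n t m (p + 2) :=
  (Finsupp.lsum k fun q : EKIndex k n t m p =>
    (basisMonomials (Fin n) k).constr k fun β => ekHomotopyTerm k m p q.1.1 q.1.2 β :
    (EKIndex k n t m p →₀ MvPolynomial (Fin n) k) →ₗ[k] EKMod k n t m (p + 2))

theorem ekHomotopy_ekTerm {p : ℕ} {i : Fin t} {J : Finset (Fin n)} {β : Fin n →₀ ℕ}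
    (h1 : ↑J ⊆ critSet k n t m i) (h2 : J.card = p) :
    ekHomotopy k m p (ekTerm k m p i J β) = ekHomotopyTerm k m p i J β := by
  rw [ekTerm_eq_single ⟨(i, J), h1, h2⟩ β]
  refine (Finsupp.lsum_single k _ _ _).trans ?_
  exact basisMonomials_constr_monomial _ _

theorem ekHomotopy_ekTerm_of_isPivot {p : ℕ} {i : Fin t} {J : Finset (Fin n)}
    {β : Fin n →₀ ℕ} (h1 : ↑J ⊆ critSet k n t m i) (h2 : J.card = p) {j : Fin n}
    (hj : IsPivot k m i J β j) :
    ekHomotopy k m p (ekTerm k m p i J β) =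
      ekTerm k m (p + 1) i (insert j J) (β - Finsupp.single j 1) := by
  have h : ∃ j, IsPivot k m i J β j := ⟨j, hj⟩
  rw [ekHomotopy_ekTerm h1 h2, ekHomotopyTerm, dif_pos h, h.choose_spec.unique hj]

theorem ekHomotopy_ekTerm_of_not_isPivot {p : ℕ} {i : Fin t} {J : Finset (Fin n)}
    {β : Fin n →₀ ℕ} (h1 : ↑J ⊆ critSet k n t m i) (h2 : J.card = p)
    (hj : ∀ j, ¬ IsPivot k m i J β j) :
    ekHomotopy k m p (ekTerm k m p i J β) = 0 := by
  rw [ekHomotopy_ekTerm h1 h2, ekHomotopyTerm, dif_neg (not_exists.2 hj)]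

theorem ekHomotopy_mem_ekFiltration {p l : ℕ} {z : EKMod k n t m (p + 1)}
    (hz : z ∈ ekFiltration k m p l) : ekHomotopy k m p z ∈ ekFiltration k m (p + 1) l := by
  refine Submodule.span_le (p := (ekFiltration k m (p + 1) l).comap (ekHomotopy k m p)) |>.2 ?_ hz
  rintro _ ⟨i, J, β, hi, rfl⟩
  simp only [Submodule.comap_coe, Set.mem_preimage, SetLike.mem_coe]
  by_cases h : ↑J ⊆ critSet k n t m i ∧ J.card = p
  · rw [ekHomotopy_ekTerm h.1 h.2, ekHomotopyTerm]
    split_ifs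
    · exact ekTerm_mem_ekFiltration hi _ _
    · exact Submodule.zero_mem _
  · rw [ekTerm, dif_neg h, map_zero]
    exact Submodule.zero_mem _

variable (k m) in
/-- The `k`-linear map `S → G̃_1` sending `x^α` to `x^{α - m_l} g_l`, where `m_l` is the first
generator dividing `x^α`, and to `0` if there is none. -/
noncomputable def ekHomotopyZero : EKMod k n t m 0 →ₗ[k] EKMod k n t m 1 :=
  ((basisMonomials (Fin n) k).constr k fun α =>
    if h : ∃ l, m l ≤ α ∧ ∀ l', m l' ≤ α → l ≤ l' then
      ekTerm k m 0 h.choose ∅ (α - m h.choose) else 0 :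
    MvPolynomial (Fin n) k →ₗ[k] EKMod k n t m 1)

theorem ekHomotopyZero_monomial {α : Fin n →₀ ℕ} {l : Fin t} (h1 : m l ≤ α)
    (h2 : ∀ l', m l' ≤ α → l ≤ l') :
    ekHomotopyZero k m (ekMonomial k m α) =
      ekTerm k m 0 l ∅ (α - m l) := by
  have h : ∃ l, m l ≤ α ∧ ∀ l', m l' ≤ α → l ≤ l' := ⟨l, h1, h2⟩
  have hl : h.choose = l := le_antisymm (h.choose_spec.2 _ h1) (h2 _ h.choose_spec.1)
  refine (basisMonomials_constr_monomial _ _).trans ?_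
  rw [dif_pos h, hl]

/-- `(-1)` to the number of elements of `J` below `j`. -/
def koszulSign {n : ℕ} (J : Finset (Fin n)) (j : Fin n) : ℤ :=
  (-1) ^ (J.filter (· < j)).card

theorem koszulSign_insert_of_lt {n : ℕ} {J : Finset (Fin n)} {j s : Fin n} (hj : j ∉ J)
    (h : j < s) : koszulSign (insert j J) s = -koszulSign J s := by
  rw [koszulSign, Finset.filter_insert, if_pos h, Finset.card_insert_of_notMem (by simp [hj]),
    pow_succ, koszulSign, mul_neg_one]

theorem koszulSign_insert_of_le {n : ℕ} {J : Finset (Fin n)} {j s : Fin n}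
    (h : s ≤ j) : koszulSign (insert j J) s = koszulSign J s := by
  rw [koszulSign, Finset.filter_insert, if_neg h.not_gt, koszulSign]

theorem koszulSign_eq_one {n : ℕ} {J : Finset (Fin n)} {j : Fin n} (h : ∀ x ∈ J, j ≤ x) :
    koszulSign J j = 1 := by
  rw [koszulSign, Finset.filter_eq_empty_iff.2 fun x hx => (h x hx).not_gt]
  simp

theorem koszulSign_mul_erase {n : ℕ} {J : Finset (Fin n)} {j s : Fin n} (hj : j ∈ J)
    (hs : s ∈ J) (h : j ≠ s) : koszulSign J j * koszulSign (J.erase j) s =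
      -(koszulSign J s * koszulSign (J.erase s) j) := by
  wlog hlt : j < s generalizing j s
  · rw [this hs hj h.symm (h.lt_or_gt.resolve_left hlt), neg_neg]
  have h1 := koszulSign_insert_of_lt (Finset.notMem_erase j J) hlt
  have h2 := koszulSign_insert_of_le (J := J.erase s) hlt.le
  rw [Finset.insert_erase hj] at h1
  rw [Finset.insert_erase hs] at h2
  rw [h1, h2]
  ring

theorem sum_koszulSign_eq_zero {n : ℕ} {M : Type*} [AddCommGroup M] (J : Finset (Fin n))
    (f : Fin n → Fin n → M) (hf : ∀ j ∈ J, ∀ s ∈ J, j ≠ s → f j s = f s j) :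
    ∑ j ∈ J, ∑ s ∈ J.erase j, (koszulSign J j * koszulSign (J.erase j) s) • f j s = 0 := by
  rw [Finset.sum_sigma']
  refine Finset.sum_involution (fun a _ => ⟨a.2, a.1⟩) ?_ ?_ ?_ ?_
  · rintro ⟨j, s⟩ h
    simp only [Finset.mem_sigma, Finset.mem_erase] at h
    rw [koszulSign_mul_erase h.1 h.2.2 h.2.1.symm, hf j h.1 s h.2.2 h.2.1.symm, neg_smul]
    exact neg_add_cancel _
  · rintro ⟨j, s⟩ h _ h'
    simp only [Finset.mem_sigma, Finset.mem_erase] at h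
    simp only [Sigma.mk.injEq, heq_eq_eq] at h'
    exact h.2.1 h'.1
  · rintro ⟨j, s⟩ h
    simp only [Finset.mem_sigma, Finset.mem_erase] at h ⊢
    exact ⟨h.2.2, h.2.1.symm, h.1⟩
  · rintro ⟨j, s⟩ h
    rfl

theorem monomial_mem_span_monomial_iff {s : Set (Fin t)} {β : Fin n →₀ ℕ} :
    monomial β (1 : k) ∈ Ideal.span ((fun j => monomial (m j) (1 : k)) '' s) ↔
      ∃ l ∈ s, m l ≤ β := by
  have h : (fun j => monomial (m j) (1 : k)) '' s =
      (fun γ => monomial γ (1 : k)) '' (m '' s) := by rw [Set.image_image]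
  rw [h, mem_ideal_span_monomial_image]
  simp

theorem monomial_mem_colonIdeal_iff {i : Fin t} {β : Fin n →₀ ℕ} :
    monomial β (1 : k) ∈ colonIdeal k n t m i ↔ ∃ l < i, m l ≤ β + m i := by
  rw [colonIdeal, Submodule.mem_colon]
  constructor
  · intro h
    have := h _ (Ideal.subset_span (Set.mem_singleton _))
    rw [smul_eq_mul, monomial_mul, one_mul, monomial_mem_span_monomial_iff] at this
    exact this
  · rintro ⟨l, hl, h⟩ s hs
    obtain ⟨a, rfl⟩ := Ideal.mem_span_singleton.1 hs
    rw [smul_eq_mul, ← mul_assoc, monomial_mul, one_mul]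
    exact Ideal.mul_mem_right _ _ (monomial_mem_span_monomial_iff.2 ⟨l, hl, h⟩)

theorem mem_critSet_iff {i : Fin t} {j : Fin n} :
    j ∈ critSet k n t m i ↔ ∃ l < i, m l ≤ Finsupp.single j 1 + m i :=
  monomial_mem_colonIdeal_iff

theorem exists_mem_critSet_of_le
    (hLQ : ∀ i : Fin t, ∃ V : Set (Fin n),
      colonIdeal k n t m i = Ideal.span ((fun g => (X g : MvPolynomial (Fin n) k)) '' V))
    {i l : Fin t} {β : Fin n →₀ ℕ} (hl : l < i) (h : m l ≤ β + m i) :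
    ∃ j ∈ critSet k n t m i, β j ≠ 0 := by
  obtain ⟨V, hV⟩ := hLQ i
  have h1 : monomial β (1 : k) ∈ colonIdeal k n t m i := monomial_mem_colonIdeal_iff.2 ⟨l, hl, h⟩
  rw [hV, mem_ideal_span_X_image] at h1
  obtain ⟨j, hj, h2⟩ := h1 β (by simp)
  refine ⟨j, ?_, h2⟩
  change X j ∈ colonIdeal k n t m i
  rw [hV]
  exact Ideal.subset_span ⟨j, hj, rfl⟩

theorem le_of_disjoint_critSet
    (hLQ : ∀ i : Fin t, ∃ V : Set (Fin n),
      colonIdeal k n t m i = Ideal.span ((fun g => (X g : MvPolynomial (Fin n) k)) '' V))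
    {i l : Fin t} {β : Fin n →₀ ℕ} (hβ : ∀ j ∈ β.support, j ∉ critSet k n t m i)
    (h : m l ≤ β + m i) : i ≤ l := by
  by_contra! hl
  obtain ⟨j, hj, h0⟩ := exists_mem_critSet_of_le hLQ hl h
  exact hβ j (Finsupp.mem_support_iff.2 h0) hj

/-- Uniqueness of the decomposition `x^α = x^β m_i` with `supp β ∩ A_i = ∅`. -/
theorem decomposition_unique
    (hLQ : ∀ i : Fin t, ∃ V : Set (Fin n),
      colonIdeal k n t m i = Ideal.span ((fun g => (X g : MvPolynomial (Fin n) k)) '' V))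
    {i l : Fin t} {β γ : Fin n →₀ ℕ} (hβ : ∀ j ∈ β.support, j ∉ critSet k n t m i)
    (hγ : ∀ j ∈ γ.support, j ∉ critSet k n t m l) (h : β + m i = γ + m l) :
    i = l ∧ β = γ := by
  obtain rfl : i = l := le_antisymm
    (le_of_disjoint_critSet hLQ hβ (h ▸ le_add_self))
    (le_of_disjoint_critSet hLQ hγ (h ▸ le_add_self))
  exact ⟨rfl, add_right_cancel h⟩

/-- A differential on `G̃` together with the facts on the decompositions
`x_j m_i = u(i,j) m_{κ(i,j)}` on which its exactness rests. -/
structure IsEKDifferential (k : Type) [Field k] {n t : ℕ} (m : Fin t → (Fin n →₀ ℕ))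
    (κ : Fin t → Fin n → Fin t) (u : Fin t → Fin n → (Fin n →₀ ℕ))
    (d : ∀ p : ℕ, EKMod k n t m (p + 1) →ₗ[MvPolynomial (Fin n) k] EKMod k n t m p) :
    Prop where
  linearQuotients : ∀ i : Fin t, ∃ V : Set (Fin n),
    colonIdeal k n t m i = Ideal.span ((fun g => (X g : MvPolynomial (Fin n) k)) '' V)
  decomp : ∀ i : Fin t, ∀ j ∈ critSet k n t m i,
    Finsupp.single j 1 + m i = u i j + m (κ i j)
  disjoint : ∀ i : Fin t, ∀ j ∈ critSet k n t m i, ∀ g ∈ (u i j).support,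
    g ∉ critSet k n t m (κ i j)
  critSet_subset : ∀ i : Fin t, ∀ j ∈ critSet k n t m i,
    critSet k n t m (κ i j) ⊆ critSet k n t m i
  zero_apply : ∀ (i : Fin t) (β : Fin n →₀ ℕ), d 0 (ekTerm k m 0 i ∅ β) =
    ekMonomial k m (β + m i)
  succ_apply : ∀ (p : ℕ) (i : Fin t) (J : Finset (Fin n)) (β : Fin n →₀ ℕ),
    ↑J ⊆ critSet k n t m i → J.card = p + 1 →
    d (p + 1) (ekTerm k m (p + 1) i J β) = ∑ j ∈ J, koszulSign J j •
      (ekTerm k m p i (J.erase j) (Finsupp.single j 1 + β) -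
        ekTerm k m p (κ i j) (J.erase j) (u i j + β))

namespace IsEKDifferential

variable {κ : Fin t → Fin n → Fin t} {u : Fin t → Fin n → (Fin n →₀ ℕ)}
  {d : ∀ p : ℕ, EKMod k n t m (p + 1) →ₗ[MvPolynomial (Fin n) k] EKMod k n t m p}

theorem lt (h : IsEKDifferential k m κ u d) {i : Fin t} {j : Fin n}
    (hj : j ∈ critSet k n t m i) : κ i j < i := by
  obtain ⟨l, hl, hle⟩ := mem_critSet_iff.1 hj
  rw [h.decomp i j hj] at hle
  exact (le_of_disjoint_critSet h.linearQuotients (h.disjoint i j hj) hle).trans_lt hl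

/-- The decompositions of `x_s x_j m_i` obtained by multiplying with `x_j` first. -/
theorem decomp_of_mem (h : IsEKDifferential k m κ u d) {i : Fin t} {j s : Fin n}
    (hj : j ∈ critSet k n t m i) (hs : s ∈ critSet k n t m (κ i j)) :
    (u i j + u (κ i j) s) + m (κ (κ i j) s) = Finsupp.single j 1 + Finsupp.single s 1 + m i ∧
      ∀ g ∈ (u i j + u (κ i j) s).support, g ∉ critSet k n t m (κ (κ i j) s) := by
  refine ⟨?_, fun g hg hg' => ?_⟩
  · rw [add_assoc, ← h.decomp _ _ hs, add_left_comm, ← h.decomp _ _ hj]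
    abel
  · rcases Finset.mem_union.1 (Finsupp.support_add hg) with hg | hg
    · exact h.disjoint i j hj g hg (h.critSet_subset _ _ hs hg')
    · exact h.disjoint _ s hs g hg hg'

theorem decomp_of_notMem (h : IsEKDifferential k m κ u d) {i : Fin t} {j s : Fin n}
    (hj : j ∈ critSet k n t m i) (hs : s ∉ critSet k n t m (κ i j)) :
    (u i j + Finsupp.single s 1) + m (κ i j) =
        Finsupp.single j 1 + Finsupp.single s 1 + m i ∧
      ∀ g ∈ (u i j + Finsupp.single s 1).support, g ∉ critSet k n t m (κ i j) := by
  refine ⟨?_, fun g hg hg' => ?_⟩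
  · rw [add_right_comm, ← h.decomp _ _ hj]
    abel
  · rcases Finset.mem_union.1 (Finsupp.support_add hg) with hg | hg
    · exact h.disjoint i j hj g hg hg'
    · rw [Finset.mem_singleton.1 (Finsupp.support_single_subset hg)] at hg'
      exact hs hg'

/-- The decomposition of `x_s x_j m_i` governs the second-order terms of `d ∘ d`. -/
theorem exists_decomp (h : IsEKDifferential k m κ u d) (i : Fin t) (j s : Fin n) :
    ∃ (l : Fin t) (γ : Fin n →₀ ℕ), j ∈ critSet k n t m i →
      γ + m l = Finsupp.single j 1 + Finsupp.single s 1 + m i ∧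
      (∀ g ∈ γ.support, g ∉ critSet k n t m l) ∧
      ∀ (p : ℕ) (K : Finset (Fin n)) (β : Fin n →₀ ℕ),
        (if s ∈ critSet k n t m (κ i j) ∧ ↑K ⊆ critSet k n t m (κ i j) then
          ekTerm k m p (κ i j) K (Finsupp.single s 1 + (u i j + β)) -
            ekTerm k m p (κ (κ i j) s) K (u (κ i j) s + (u i j + β)) else 0) =
        ekTerm k m p (κ i j) K (u i j + (Finsupp.single s 1 + β)) -
          ekTerm k m p l K (γ + β) := by
  by_cases hs : s ∈ critSet k n t m (κ i j)
  · refine ⟨_, _, fun hj => ⟨(h.decomp_of_mem hj hs).1, (h.decomp_of_mem hj hs).2,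
      fun p K β => ?_⟩⟩
    by_cases hK : ↑K ⊆ critSet k n t m (κ i j)
    · rw [if_pos ⟨hs, hK⟩, add_left_comm, ← add_assoc (u (κ i j) s), add_comm (u (κ i j) s)]
    · rw [if_neg fun h => hK h.2, ekTerm_eq_zero _ hK,
        ekTerm_eq_zero _ fun h' => hK (h'.trans (h.critSet_subset _ _ hs)), sub_zero]
  · refine ⟨_, _, fun hj => ⟨(h.decomp_of_notMem hj hs).1, (h.decomp_of_notMem hj hs).2,
      fun p K β => ?_⟩⟩
    rw [if_neg fun h => hs h.1, add_assoc, sub_self]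

theorem apply_apply_ekTerm (h : IsEKDifferential k m κ u d) {p : ℕ} {i : Fin t}
    {J : Finset (Fin n)} (β : Fin n →₀ ℕ) (h1 : ↑J ⊆ critSet k n t m i)
    (h2 : J.card = p + 2) : d (p + 1) (d (p + 2) (ekTerm k m (p + 2) i J β)) = 0 := by
  choose l γ hγ hdisj hterm using h.exists_decomp i
  let f : Fin n → Fin n → EKMod k n t m (p + 1) := fun j s =>
    ekTerm k m p i ((J.erase j).erase s) (Finsupp.single s 1 + (Finsupp.single j 1 + β)) -
      ekTerm k m p (κ i s) ((J.erase j).erase s) (u i s + (Finsupp.single j 1 + β)) -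
      (ekTerm k m p (κ i j) ((J.erase j).erase s) (u i j + (Finsupp.single s 1 + β)) -
        ekTerm k m p (l j s) ((J.erase j).erase s) (γ j s + β))
  have hf : ∀ j ∈ J, ∀ s ∈ J, j ≠ s → f j s = f s j := fun j hj s hs _ => by
    obtain ⟨h3, h4⟩ := decomposition_unique h.linearQuotients (hdisj j s (h1 hj))
      (hdisj s j (h1 hs)) (by
        rw [hγ j s (h1 hj), hγ s j (h1 hs), add_comm (Finsupp.single j 1)])
    simp only [f]
    rw [Finset.erase_right_comm, h3, h4, add_left_comm (Finsupp.single s 1)]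
    abel
  rw [← sum_koszulSign_eq_zero J f hf, h.succ_apply _ _ _ _ h1 h2, map_sum]
  refine Finset.sum_congr rfl fun j hj => ?_
  have hc : (J.erase j).card = p + 1 := by rw [Finset.card_erase_of_mem hj, h2]; rfl
  have hsub : ↑(J.erase j) ⊆ critSet k n t m i := fun x hx => h1 (Finset.erase_subset _ _ hx)
  have hκ : d (p + 1) (ekTerm k m (p + 1) (κ i j) (J.erase j) (u i j + β)) =
      ∑ s ∈ J.erase j, koszulSign (J.erase j) s •
        (ekTerm k m p (κ i j) ((J.erase j).erase s) (u i j + (Finsupp.single s 1 + β)) -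
          ekTerm k m p (l j s) ((J.erase j).erase s) (γ j s + β)) := by
    by_cases hJ : ↑(J.erase j) ⊆ critSet k n t m (κ i j)
    · rw [h.succ_apply _ _ _ _ hJ hc]
      refine Finset.sum_congr rfl fun s hs => ?_
      rw [← hterm j s (h1 hj), if_pos ⟨hJ hs, fun x hx => hJ (Finset.erase_subset _ _ hx)⟩]
    · rw [ekTerm_eq_zero _ hJ, map_zero]
      refine (Finset.sum_eq_zero fun s hs => ?_).symm
      rw [← hterm j s (h1 hj), if_neg, smul_zero]
      rintro ⟨h3, h4⟩
      refine hJ fun x hx => ?_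
      by_cases hxs : x = s
      · exact hxs ▸ h3
      · exact h4 (Finset.mem_erase.2 ⟨hxs, hx⟩)
  rw [map_zsmul, map_sub, h.succ_apply _ _ _ _ hsub hc, hκ, ← Finset.sum_sub_distrib,
    Finset.smul_sum]
  refine Finset.sum_congr rfl fun s _ => ?_
  rw [← smul_sub, smul_smul]

theorem apply_apply (h : IsEKDifferential k m κ u d) (p : ℕ) (x : EKMod k n t m (p + 2)) :
    d p (d (p + 1) x) = 0 := by
  have htop := eq_top_of_ekTerm_mem
    ((LinearMap.ker (d p ∘ₗ d (p + 1))).restrictScalars k) fun i J β h1 h2 => ?_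
  · have hx : x ∈ (LinearMap.ker (d p ∘ₗ d (p + 1))).restrictScalars k := htop ▸ Submodule.mem_top
    exact hx
  · simp only [Submodule.restrictScalars_mem, LinearMap.mem_ker, LinearMap.comp_apply]
    cases p with
    | zero =>
      obtain ⟨j, rfl⟩ := Finset.card_eq_one.1 h2
      have hj : j ∈ critSet k n t m i := h1 (by simp)
      rw [h.succ_apply _ _ _ _ h1 h2, Finset.sum_singleton, map_zsmul, map_sub,
        Finset.erase_singleton, h.zero_apply, h.zero_apply, add_right_comm, h.decomp _ _ hj,
        add_right_comm, sub_self, smul_zero]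
    | succ p => exact h.apply_apply_ekTerm β h1 h2

/-- Modulo terms with smaller index, `ekHomotopy` is a contracting homotopy in degree at
least two. -/
theorem homotopy_ekTerm_succ (h : IsEKDifferential k m κ u d) {p : ℕ} {i : Fin t}
    {J : Finset (Fin n)} (β : Fin n →₀ ℕ) (h1 : ↑J ⊆ critSet k n t m i)
    (h2 : J.card = p + 1) :
    ekTerm k m (p + 1) i J β - d (p + 2) (ekHomotopy k m (p + 1) (ekTerm k m (p + 1) i J β)) -
      ekHomotopy k m p (d (p + 1) (ekTerm k m (p + 1) i J β)) ∈
        ekFiltration k m (p + 1) i := by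
  have hsub : ∀ j, ↑(J.erase j) ⊆ critSet k n t m i :=
    fun j x hx => h1 (Finset.erase_subset _ _ hx)
  have hcard : ∀ j ∈ J, (J.erase j).card = p := fun j hj => by
    rw [Finset.card_erase_of_mem hj, h2]; rfl
  have hlow : ∀ (q : ℕ) (K : Finset (Fin n)), ↑K ⊆ critSet k n t m i →
      ∑ j ∈ K, koszulSign K j • ekTerm k m q (κ i j) (K.erase j) (u i j + β) ∈
        ekFiltration k m q i := fun q K hK =>
    Submodule.sum_mem _ fun j hj =>
      zsmul_mem (ekTerm_mem_ekFiltration (Fin.lt_def.1 (h.lt (hK hj))) _ _) _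
  have hd : ekHomotopy k m p (d (p + 1) (ekTerm k m (p + 1) i J β)) =
      (∑ j ∈ J, koszulSign J j • ekHomotopy k m p
        (ekTerm k m p i (J.erase j) (Finsupp.single j 1 + β))) -
      ekHomotopy k m p
        (∑ j ∈ J, koszulSign J j • ekTerm k m p (κ i j) (J.erase j) (u i j + β)) := by
    rw [h.succ_apply _ _ _ _ h1 h2]
    simp only [smul_sub, Finset.sum_sub_distrib, map_sub, map_sum, map_zsmul]
  rw [hd]
  have hJ : J.Nonempty := Finset.card_pos.1 (by omega)
  by_cases hj : ∃ j, IsPivot k m i J β j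
  · obtain ⟨j, hj⟩ := hj
    have hins : ↑(insert j J) ⊆ critSet k n t m i := by
      intro x hx
      rcases Finset.mem_insert.1 hx with rfl | hx
      exacts [hj.1, h1 hx]
    have hle : Finsupp.single j 1 ≤ β := by
      rw [Finsupp.single_le_iff]
      exact Nat.one_le_iff_ne_zero.2 hj.2.1
    have hsum : ∑ s ∈ J, koszulSign J s • ekHomotopy k m p
          (ekTerm k m p i (J.erase s) (Finsupp.single s 1 + β)) =
        -∑ s ∈ J, koszulSign (insert j J) s • ekTerm k m (p + 1) i ((insert j J).erase s)
          (Finsupp.single s 1 + (β - Finsupp.single j 1)) := by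
      rw [← Finset.sum_neg_distrib]
      refine Finset.sum_congr rfl fun s hs => ?_
      have hjs : j < s := (hj.2.2.2.1 s hs).lt_of_ne fun e => hj.2.2.1 (e ▸ hs)
      have hpiv : IsPivot k m i (J.erase s) (Finsupp.single s 1 + β) j := by
        refine ⟨hj.1, ?_, fun h' => hj.2.2.1 (Finset.mem_of_mem_erase h'),
          fun x hx => hj.2.2.2.1 x (Finset.mem_of_mem_erase hx), fun x hx hx0 => ?_⟩
        · rw [Finsupp.add_apply]
          have := hj.2.1
          omega
        · by_cases hxs : x = s
          · exact hxs ▸ hjs.le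
          · rw [Finsupp.add_apply, Finsupp.single_eq_of_ne hxs, zero_add] at hx0
            exact hj.2.2.2.2 x hx hx0
      rw [ekHomotopy_ekTerm_of_isPivot (hsub s) (hcard s hs) hpiv,
        koszulSign_insert_of_lt hj.2.2.1 hjs, Finset.erase_insert_of_ne hjs.ne,
        add_tsub_assoc_of_le hle, neg_smul, neg_neg]
    have hc : (insert j J).card = p + 1 + 1 := by
      rw [Finset.card_insert_of_notMem hj.2.2.1, h2]
    have hone : koszulSign (insert j J) j = 1 := koszulSign_eq_one fun x hx => by
      rcases Finset.mem_insert.1 hx with rfl | hx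
      exacts [le_rfl, hj.2.2.2.1 x hx]
    rw [ekHomotopy_ekTerm_of_isPivot h1 h2 hj, h.succ_apply _ _ _ _ hins hc, hsum]
    simp only [smul_sub, Finset.sum_sub_distrib]
    rw [Finset.sum_insert hj.2.2.1 (f := fun s => koszulSign (insert j J) s •
      ekTerm k m (p + 1) i ((insert j J).erase s) _), hone, one_smul,
      Finset.erase_insert hj.2.2.1, add_tsub_cancel_of_le hle]
    have hmem := Submodule.add_mem _ (ekHomotopy_mem_ekFiltration (hlow p J h1))
      (Submodule.sum_mem (ekFiltration k m (p + 1) i) fun s (hs : s ∈ insert j J) =>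
        zsmul_mem (ekTerm_mem_ekFiltration (p := p + 1) (Fin.lt_def.1 (h.lt (hins hs)))
          ((insert j J).erase s) (u i s + (β - Finsupp.single j 1)))
            (koszulSign (insert j J) s))
    convert hmem using 1
    abel
  · rw [not_exists] at hj
    have hmin : ∀ x ∈ critSet k n t m i, β x ≠ 0 → J.min' hJ ≤ x := fun x hx hx0 => by
      by_contra! hlt
      obtain ⟨j, hj1, hj2, hle⟩ := exists_least_mem_critSet hx hx0
      refine hj j ⟨hj1, hj2, fun hJ' => ?_, fun y hy => ?_, hle⟩
      · exact ((Finset.min'_le _ _ hJ').trans (hle x hx hx0)).not_gt hlt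
      · exact (hle x hx hx0).trans (hlt.le.trans (Finset.min'_le _ _ hy))
    have hmemJ := Finset.min'_mem J hJ
    rw [ekHomotopy_ekTerm_of_not_isPivot h1 h2 hj, map_zero, sub_zero,
      Finset.sum_eq_single_of_mem _ hmemJ]
    · have hpiv : IsPivot k m i (J.erase (J.min' hJ)) (Finsupp.single (J.min' hJ) 1 + β)
          (J.min' hJ) := by
        refine ⟨h1 hmemJ, by simp, Finset.notMem_erase _ _,
          fun x hx => Finset.min'_le _ _ (Finset.mem_of_mem_erase hx), fun x hx hx0 => ?_⟩
        by_cases hxs : x = J.min' hJ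
        · exact hxs ▸ le_rfl
        · rw [Finsupp.add_apply, Finsupp.single_eq_of_ne hxs, zero_add] at hx0
          exact hmin x hx hx0
      rw [ekHomotopy_ekTerm_of_isPivot (hsub _) (hcard _ hmemJ) hpiv,
        koszulSign_eq_one (fun x hx => Finset.min'_le _ _ hx), one_smul,
        Finset.insert_erase hmemJ, add_tsub_cancel_left, sub_sub_cancel]
      exact ekHomotopy_mem_ekFiltration (hlow p J h1)
    · intro s hs hne
      have hlt : J.min' hJ < s := (Finset.min'_le _ _ hs).lt_of_ne hne.symm
      rw [ekHomotopy_ekTerm_of_not_isPivot (hsub s) (hcard s hs), smul_zero]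
      rintro j ⟨hj1, hj2, hj3, hj4, hj5⟩
      have hj6 := hj4 _ (Finset.mem_erase.2 ⟨hlt.ne, hmemJ⟩)
      have hjs : j ≠ s := (hj6.trans_lt hlt).ne
      rw [Finsupp.add_apply, Finsupp.single_eq_of_ne hjs, zero_add] at hj2
      obtain rfl : j = J.min' hJ := le_antisymm hj6 (hmin j hj1 hj2)
      exact hj3 (Finset.mem_erase.2 ⟨hlt.ne, hmemJ⟩)

theorem homotopy_ekTerm_zero (h : IsEKDifferential k m κ u d) (i : Fin t) (β : Fin n →₀ ℕ) :
    ekTerm k m 0 i ∅ β - d 1 (ekHomotopy k m 0 (ekTerm k m 0 i ∅ β)) -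
      ekHomotopyZero k m (d 0 (ekTerm k m 0 i ∅ β)) ∈ ekFiltration k m 0 i := by
  have h1 : ↑(∅ : Finset (Fin n)) ⊆ critSet k n t m i := by simp
  rw [h.zero_apply]
  by_cases hβ : ∀ j ∈ β.support, j ∉ critSet k n t m i
  · have hj : ∀ j, ¬ IsPivot k m i ∅ β j := fun j hj =>
      hβ j (Finsupp.mem_support_iff.2 hj.2.1) hj.1
    rw [ekHomotopy_ekTerm_of_not_isPivot h1 Finset.card_empty hj,
      ekHomotopyZero_monomial le_add_self fun l => le_of_disjoint_critSet h.linearQuotients hβ,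
      add_tsub_cancel_right, map_zero, sub_zero, sub_self]
    exact Submodule.zero_mem _
  · push Not at hβ
    obtain ⟨x, hx0, hx⟩ := hβ
    rw [Finsupp.mem_support_iff] at hx0
    obtain ⟨j, hj⟩ : ∃ j, IsPivot k m i ∅ β j := by
      obtain ⟨j, hj1, hj2, hle⟩ := exists_least_mem_critSet hx hx0
      exact ⟨j, hj1, hj2, by simp, by simp, hle⟩
    have hle : Finsupp.single j 1 ≤ β := by
      rw [Finsupp.single_le_iff]
      exact Nat.one_le_iff_ne_zero.2 hj.2.1
    obtain ⟨l₀, hl₀, hle₀⟩ := mem_critSet_iff.1 hj.1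
    obtain ⟨l, hl, hmin⟩ : ∃ l, m l ≤ β + m i ∧ ∀ l', m l' ≤ β + m i → l ≤ l' := by
      obtain ⟨l, hl, hmin⟩ := WellFounded.has_min wellFounded_lt
        {l | m l ≤ β + m i} ⟨i, (le_add_self : m i ≤ β + m i)⟩
      exact ⟨l, hl, fun l' hl' => not_lt.1 (hmin l' hl')⟩
    have hli : l < i := (hmin l₀ (hle₀.trans (add_le_add_left hle _))).trans_lt hl₀
    rw [ekHomotopy_ekTerm_of_isPivot h1 Finset.card_empty hj, ekHomotopyZero_monomial hl hmin,
      h.succ_apply _ _ _ _ (by simpa using hj.1) rfl, insert_empty_eq, Finset.sum_singleton,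
      koszulSign_eq_one (by simp), one_smul, Finset.erase_singleton,
      add_tsub_cancel_of_le hle, sub_sub_cancel]
    exact Submodule.sub_mem _ (ekTerm_mem_ekFiltration (Fin.lt_def.1 (h.lt hj.1)) _ _)
      (ekTerm_mem_ekFiltration (Fin.lt_def.1 hli) _ _)

theorem exists_homotopy (h : IsEKDifferential k m κ u d) (p : ℕ) :
    ∃ (f : EKMod k n t m (p + 1) →ₗ[k] EKMod k n t m (p + 2))
      (g : EKMod k n t m p →ₗ[k] EKMod k n t m (p + 1)),
      ∀ (i : Fin t) (J : Finset (Fin n)) (β : Fin n →₀ ℕ),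
        ekTerm k m p i J β - d (p + 1) (f (ekTerm k m p i J β)) - g (d p (ekTerm k m p i J β)) ∈
          ekFiltration k m p i := by
  cases p with
  | zero =>
    refine ⟨ekHomotopy k m 0, ekHomotopyZero k m, fun i J β => ?_⟩
    by_cases hJ : ↑J ⊆ critSet k n t m i ∧ J.card = 0
    · obtain rfl := Finset.card_eq_zero.1 hJ.2
      exact h.homotopy_ekTerm_zero i β
    · rw [ekTerm, dif_neg hJ]
      simp
  | succ p =>
    refine ⟨ekHomotopy k m (p + 1), ekHomotopy k m p, fun i J β => ?_⟩
    by_cases hJ : ↑J ⊆ critSet k n t m i ∧ J.card = p + 1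
    · exact h.homotopy_ekTerm_succ β hJ.1 hJ.2
    · rw [ekTerm, dif_neg hJ]
      simp

theorem ker_le_range (h : IsEKDifferential k m κ u d) (p : ℕ) :
    LinearMap.ker (d p) ≤ LinearMap.range (d (p + 1)) := by
  obtain ⟨f, g, hfg⟩ := h.exists_homotopy p
  let T : EKMod k n t m (p + 1) →ₗ[k] EKMod k n t m (p + 1) :=
    LinearMap.id - (d (p + 1)).restrictScalars k ∘ₗ f - g ∘ₗ (d p).restrictScalars k
  have hT : ∀ l : ℕ, ∀ z ∈ ekFiltration k m p (l + 1), T z ∈ ekFiltration k m p l := by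
    intro l z hz
    refine Submodule.span_le (p := (ekFiltration k m p l).comap T) |>.2 ?_ hz
    rintro _ ⟨i, J, β, hi, rfl⟩
    exact ekFiltration_mono (Nat.lt_succ_iff.1 hi) (hfg i J β)
  have key : ∀ l : ℕ, ∀ z ∈ ekFiltration k m p l, d p z = 0 →
      z ∈ LinearMap.range (d (p + 1)) := by
    intro l
    induction l with
    | zero =>
      intro z hz _
      rw [ekFiltration_zero, Submodule.mem_bot] at hz
      exact hz ▸ Submodule.zero_mem _
    | succ l ih =>
      intro z hz hdz
      have hTz : T z = z - d (p + 1) (f z) := by simp [T, hdz]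
      have := ih (T z) (hT l z hz) (by rw [hTz, map_sub, h.apply_apply, hdz, sub_zero])
      rw [hTz] at this
      simpa using Submodule.add_mem _ this (LinearMap.mem_range_self (d (p + 1)) (f z))
  exact fun z hz => key t z (ekFiltration_eq_top (k := k) (m := m) p ▸ Submodule.mem_top) hz

end IsEKDifferential

theorem ekMod_top_le {p : ℕ} {N : Submodule (MvPolynomial (Fin n) k) (EKMod k n t m (p + 1))}
    (h : ∀ (i : Fin t) (J : Finset (Fin n)) (h1 : ↑J ⊆ critSet k n t m i) (h2 : J.card = p),
      ekGen k n t m i J h1 h2 ∈ N) : ⊤ ≤ N := by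
  have := eq_top_of_ekTerm_mem (N.restrictScalars k) fun i J β h1 h2 => by
    rw [ekTerm, dif_pos ⟨h1, h2⟩]
    exact N.smul_mem _ (h i J h1 h2)
  intro x _
  have hx : x ∈ N.restrictScalars k := this ▸ Submodule.mem_top
  exact hx

theorem monomial_mem_span_X {u : Fin n →₀ ℕ} (hu : u ≠ 0) :
    monomial u (1 : k) ∈ Ideal.span (Set.range (X : Fin n → MvPolynomial (Fin n) k)) := by
  rw [← Set.image_univ, mem_ideal_span_X_image]
  intro v hv
  rw [Finset.mem_singleton.1 (support_monomial_subset hv)]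
  obtain ⟨j, hj⟩ := Finsupp.ne_iff.1 hu
  exact ⟨j, Set.mem_univ _, hj⟩

end EliahouKervaire

/-- Let `I ⊆ S = k[x_1,…,x_n]` be a monomial ideal with linear quotients
with respect to `m_1, …, m_t`, with critical-index sets `A_i`, and assume `I` is
crit-monotone.  Then the Eliahou–Kervaire-type complex `G̃` is a minimal free resolution
of `S/I`: `d ∘ d = 0`, `H_p(G̃) = 0` for `p ≥ 1`, the image of `d_1 : G̃_1 → G̃_0 = S`
equals `I` (so `H_0(G̃) ≅ S/I`), and `d(G̃_p) ⊆ (x_1,…,x_n)·G̃_{p−1}` for all `p ≥ 1`. -/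
theorem stmt_5 (k : Type) [Field k] (n t : ℕ)
    (m : Fin t → (Fin n →₀ ℕ))
    (hproper : ∀ i, m i ≠ 0)
    (hmin : ∀ i j : Fin t, i ≠ j → ¬ m i ≤ m j)
    -- linear quotients
    (hLQ : ∀ i : Fin t, ∃ V : Set (Fin n),
      colonIdeal k n t m i = Ideal.span ((fun g => (X g : MvPolynomial (Fin n) k)) '' V))
    -- the (unique) decompositions `x_j·m_i = u(i,j)·m_{κ(i,j)}` with
    -- `supp u(i,j) ∩ A_{κ(i,j)} = ∅`, for `j ∈ A_i`
    (κ : Fin t → Fin n → Fin t) (u : Fin t → Fin n → (Fin n →₀ ℕ))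
    (hκu : ∀ i : Fin t, ∀ j ∈ critSet k n t m i,
      Finsupp.single j 1 + m i = u i j + m (κ i j) ∧
      ∀ g ∈ (u i j).support, g ∉ critSet k n t m (κ i j))
    -- crit-monotonicity
    (hcm : ∀ i : Fin t, ∀ j ∈ critSet k n t m i,
      critSet k n t m (κ i j) ⊆ critSet k n t m i)
    -- the differential of `G̃`
    (d : ∀ p : ℕ, EKMod k n t m (p + 1) →ₗ[MvPolynomial (Fin n) k] EKMod k n t m p)
    (hd0 : ∀ q : EKIndex k n t m 0,
      d 0 (Finsupp.single q 1) = monomial (m q.1.1) (1 : k))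
    (hd : ∀ (p : ℕ) (i : Fin t) (J : Finset (Fin n)) (h1 : ↑J ⊆ critSet k n t m i)
        (h2 : J.card = p + 1),
      d (p + 1) (ekGen k n t m i J h1 h2) =
        ∑ j ∈ J.attach, (-1 : ℤ) ^ (J.filter (· < ↑j)).card •
          ((X (↑j : Fin n) : MvPolynomial (Fin n) k) •
              ekGen k n t m (p := p) i (J.erase ↑j)
                (fun x hx => h1 (Finset.erase_subset _ _ hx))
                (by simp [Finset.card_erase_of_mem j.2, h2])
            - if hc : ↑(J.erase (↑j : Fin n)) ⊆ critSet k n t m (κ i ↑j) then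
                (monomial (u i ↑j) (1 : k)) •
                  ekGen k n t m (p := p) (κ i ↑j) (J.erase ↑j) hc
                    (by simp [Finset.card_erase_of_mem j.2, h2])
              else 0)) :
    -- `G̃` is a minimal free resolution of `S/I`:
    (∀ p, Module.Free (MvPolynomial (Fin n) k) (EKMod k n t m p))
    ∧ (∀ (p : ℕ) (x : EKMod k n t m (p + 2)), d p (d (p + 1) x) = 0)
    ∧ (∀ p : ℕ, LinearMap.ker (d p) = LinearMap.range (d (p + 1)))
    ∧ (LinearMap.range (d 0)
        = Ideal.span (Set.range fun i => monomial (m i) (1 : k)))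
    ∧ (∀ p : ℕ, LinearMap.range (d p) ≤
        (Ideal.span (Set.range (X : Fin n → MvPolynomial (Fin n) k))) •
          (⊤ : Submodule (MvPolynomial (Fin n) k) (EKMod k n t m p))) := by
  have hd0' : ∀ (i : Fin t) (J : Finset (Fin n)) (h1 : ↑J ⊆ critSet k n t m i)
      (h2 : J.card = 0), d 0 (ekGen k n t m i J h1 h2) = ekMonomial k m (m i) :=
    fun i J h1 h2 => hd0 ⟨(i, J), h1, h2⟩
  have h : IsEKDifferential k m κ u d :=
    { linearQuotients := hLQ
      decomp := fun i j hj => (hκu i j hj).1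
      disjoint := fun i j hj => (hκu i j hj).2
      critSet_subset := hcm
      zero_apply := fun i β => by
        rw [ekTerm_eq_smul β (by simp) Finset.card_empty, map_smul, hd0',
          monomial_smul_ekMonomial]
      succ_apply := fun p i J β h1 h2 => by
        rw [ekTerm_eq_smul β h1 h2, map_smul, hd, Finset.smul_sum, ← Finset.sum_attach J]
        refine Finset.sum_congr rfl fun j _ => ?_
        have hc : (J.erase j).card = p := by rw [Finset.card_erase_of_mem j.2, h2]; rfl
        rw [smul_comm, koszulSign, smul_sub]
        congr 2
        · rw [add_comm (Finsupp.single _ _), ← monomial_smul_ekTerm, ekTerm_eq_smul]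
          rfl
        · rw [add_comm (u _ _), ← monomial_smul_ekTerm, ekTerm]
          congr 1
          by_cases hs : ↑(J.erase (j : Fin n)) ⊆ critSet k n t m (κ i j)
          · rw [dif_pos hs, dif_pos ⟨hs, hc⟩]
          · rw [dif_neg hs, dif_neg fun h' => hs h'.1] }
  refine ⟨fun p => inferInstance, h.apply_apply, fun p => le_antisymm (h.ker_le_range p) ?_,
    ?_, fun p => ?_⟩
  · rintro _ ⟨x, rfl⟩
    exact h.apply_apply p x
  · apply le_antisymm
    · let N : Submodule (MvPolynomial (Fin n) k) (EKMod k n t m 0) :=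
        (Ideal.span (Set.range fun i => monomial (m i) (1 : k)) : Ideal (MvPolynomial (Fin n) k))
      have hN : LinearMap.range (d 0) ≤ N := by
        rw [LinearMap.range_eq_map, Submodule.map_le_iff_le_comap]
        refine ekMod_top_le fun i J h1 h2 => ?_
        rw [Submodule.mem_comap, hd0']
        exact Ideal.subset_span (α := MvPolynomial (Fin n) k) ⟨i, rfl⟩
      exact hN
    · refine Submodule.span_le.2 ?_
      rintro _ ⟨i, rfl⟩
      exact ⟨_, hd0 ⟨(i, ∅), by simp, rfl⟩⟩
  · rw [LinearMap.range_eq_map, Submodule.map_le_iff_le_comap]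
    refine ekMod_top_le fun i J h1 h2 => ?_
    rw [Submodule.mem_comap]
    cases p with
    | zero =>
      rw [hd0', ← add_zero (m i), ← monomial_smul_ekMonomial]
      exact Submodule.smul_mem_smul (monomial_mem_span_X (hproper i)) Submodule.mem_top
    | succ p =>
      rw [hd]
      refine Submodule.sum_mem _ fun j _ => zsmul_mem (Submodule.sub_mem _ ?_ ?_) _
      · exact Submodule.smul_mem_smul (Ideal.subset_span ⟨_, rfl⟩) Submodule.mem_top
      · split_ifs
        · refine Submodule.smul_mem_smul (monomial_mem_span_X fun hu => ?_) Submodule.mem_top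
          have hj := h1 j.2
          have hdec := h.decomp i j hj
          rw [hu, zero_add] at hdec
          exact hmin i (κ i j) (h.lt hj).ne' (hdec ▸ le_add_self)
        · exact Submodule.zero_mem _
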